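/- arXiv:1610.00898 — 2 statements merged into one kernel-verified Lean document; each statement's English description precedes it below -/
import Mathlib

section
/- Let G be a group equipped with a linear order < such that left multiplication preserves the order, and let a, b, t ∈ G satisfy the cable-knot relations a^x = b^y and t^p = μ^q * λ^p. If not all of a, b, t equal 1, then for every integer β ≥ 1 one has μ_C^(p*q*β - 1) * λ_C^(β) ≠ 1. -/
theorem one_lt_zpow_of_mulLeftStrictMono {G : Type*} [Group G] [LinearOrder G]
    [MulLeftStrictMono G] {g : G} (hg : 1 < g) {n : ℤ} (hn : 0 < n) : 1 < g ^ n := by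
  lift n to ℕ using hn.le
  rw [zpow_natCast]
  have : MulLeftMono G := mulLeftMono_of_mulLeftStrictMono G
  exact one_lt_pow' hg (by omega)

theorem one_lt_of_one_lt_zpow {G : Type*} [Group G] [LinearOrder G]
    [MulLeftStrictMono G] {g : G} {n : ℤ} (hn : 0 ≤ n) (hg : 1 < g ^ n) : 1 < g := by
  lift n to ℕ using hn
  rw [zpow_natCast] at hg
  by_contra! h
  have : MulLeftMono G := mulLeftMono_of_mulLeftStrictMono G
  exact hg.not_ge (pow_le_one' h n)

theorem eq_one_of_zpow_eq_one_of_pos {G : Type*} [Group G] [LinearOrder G]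
    (hLO : ∀ g u v : G, u < v → g * u < g * v) {g : G} {n : ℤ} (hn : 0 < n)
    (hg : g ^ n = 1) : g = 1 := by
  have : MulLeftStrictMono G := ⟨fun g u v h => hLO g u v h⟩
  rcases lt_trichotomy g 1 with h | h | h
  · have h' : 1 < g⁻¹ := by simpa using hLO g⁻¹ g 1 h
    have := one_lt_zpow_of_mulLeftStrictMono h' hn
    simp [hg] at this
  · exact h
  · exact absurd hg (ne_of_gt (one_lt_zpow_of_mulLeftStrictMono h hn))

/-- In a left-ordered group, if `a ^ x = b ^ y` is a positive power of `t` and the torus-knot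
meridian `b ^ j * a ^ i` is at least as large a power of `t`, then `t` is not positive. -/
theorem not_one_lt_of_torus_meridian_eq_zpow {G : Type*} [Group G] [LinearOrder G]
    (hLO : ∀ g u v : G, u < v → g * u < g * v) {x y i j n m : ℤ} (hx : 0 ≤ x) (hy : 0 ≤ y)
    (hix : i < x) (hj : j < 0) (hn : 0 < n) (hnm : n ≤ m) {a b t : G}
    (ha : a ^ x = t ^ n) (hb : b ^ y = t ^ n) (hm : b ^ j * a ^ i = t ^ m) : ¬ 1 < t := by
  intro ht
  have : MulLeftStrictMono G := ⟨fun g u v h => hLO g u v h⟩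
  have hz : 1 < t ^ n := one_lt_zpow_of_mulLeftStrictMono ht hn
  have ha1 : 1 < a := one_lt_of_one_lt_zpow hx (ha ▸ hz)
  have hb1 : 1 < b := one_lt_of_one_lt_zpow hy (hb ▸ hz)
  have hai : a ^ i < t ^ n := by
    have := hLO (a ^ i) _ _ (one_lt_zpow_of_mulLeftStrictMono ha1 (sub_pos.2 hix))
    rwa [← zpow_add, add_sub_cancel, mul_one, ha] at this
  have hbj : t ^ n < b ^ (-j) * t ^ n := by
    have := hLO (t ^ n) _ _ (one_lt_zpow_of_mulLeftStrictMono hb1 (neg_pos.2 hj))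
    rwa [mul_one, ← hb, (Commute.zpow_zpow_self b y (-j)).eq, hb] at this
  have hle : t ^ n ≤ t ^ m := by
    rcases hnm.eq_or_lt with rfl | h
    · exact le_rfl
    · have := hLO (t ^ n) _ _ (one_lt_zpow_of_mulLeftStrictMono ht (sub_pos.2 h))
      rw [← zpow_add, add_sub_cancel, mul_one] at this
      exact this.le
  have hlt : b ^ j * a ^ i < t ^ n := by
    have := hLO (b ^ j) _ _ (hai.trans hbj)
    rwa [← mul_assoc, ← zpow_add, add_neg_cancel, zpow_zero, one_mul] at this
  exact (hm ▸ hlt).not_ge hle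


/-- In a left-ordered group satisfying the cable-knot relations, if not all of
a, b, t equal 1, then for every integer β ≥ 1 one has μ_C^(pqβ - 1) * λ_C^β ≠ 1. -/
theorem stmt_2 {G : Type*} [Group G] [LinearOrder G]
    (hLO : ∀ g u v : G, u < v → g * u < g * v)
    (x y i j p q : ℤ) (hx : 2 ≤ x) (hy : 2 ≤ y) (hxy : Int.gcd x y = 1)
    (hij : x * j + y * i = 1) (hi : 0 < i) (hix : i < x)
    (hp : 2 ≤ p) (hq : q = p * x * y - 1)
    (a b t mu lam muC lamC : G)
    (hmu : mu = b ^ j * a ^ i)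
    (hlam : lam = mu ^ (-(x * y)) * a ^ x)
    (hmuC : muC = mu ^ (x * y) * lam * t⁻¹)
    (hlamC : lamC = muC ^ (-(p * q)) * t ^ p)
    (rel1 : a ^ x = b ^ y)
    (rel2 : t ^ p = mu ^ q * lam ^ p)
    (hnontriv : ¬ (a = 1 ∧ b = 1 ∧ t = 1)) :
    ∀ β : ℤ, 1 ≤ β → muC ^ (p * q * β - 1) * lamC ^ β ≠ 1 := by
  intro β hβ hsurg
  have hj : j < 0 := by nlinarith
  have hxlam : mu ^ (x * y) * lam = a ^ x := by
    rw [hlam, ← mul_assoc, ← zpow_add, add_neg_cancel, zpow_zero, one_mul]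
  have hcomm : Commute mu (a ^ x) := by
    rw [hmu]
    refine Commute.mul_left ?_ (Commute.zpow_zpow_self a i x)
    rw [rel1]
    exact Commute.zpow_zpow_self b j y
  have htp : t ^ p = mu⁻¹ * (a ^ x) ^ p := by
    rw [rel2, hlam, (hcomm.zpow_left _).mul_zpow, ← zpow_mul mu, ← mul_assoc, ← zpow_add,
      ← zpow_neg_one]
    congr 2
    rw [hq]
    ring
  have htz : Commute (t ^ p) (a ^ x) := by
    rw [htp]
    exact hcomm.inv_left.mul_left (Commute.zpow_left (Commute.refl _) _)
  have hmuC' : muC = a ^ x * t⁻¹ := by rw [hmuC, hxlam]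
  have htmuC : Commute (t ^ p) muC := by
    rw [hmuC']
    exact htz.mul_right (Commute.zpow_left (Commute.refl t) p).inv_right
  have hmuCt : muC = t ^ (p * β) := by
    rw [hlamC, (htmuC.symm.zpow_left _).mul_zpow, ← zpow_mul, ← zpow_mul, ← mul_assoc,
      ← zpow_add, show p * q * β - 1 + -(p * q) * β = -1 by ring, zpow_neg_one] at hsurg
    exact (inv_mul_eq_one.1 hsurg)
  have hz : a ^ x = t ^ (p * β + 1) := by
    rw [zpow_add_one, ← hmuCt, hmuC', inv_mul_cancel_right]
  have hm : b ^ j * a ^ i = t ^ (p * (p * β)) := by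
    have : mu = (a ^ x) ^ p * (t ^ p)⁻¹ := by
      rw [eq_mul_inv_iff_mul_eq, htp, mul_inv_cancel_left]
    rw [← hmu, this, hz, ← zpow_mul, ← zpow_neg, ← zpow_add]
    congr 1
    ring
  have hpβ : 2 ≤ p * β := by nlinarith
  have hnm : p * β + 1 ≤ p * (p * β) := by nlinarith
  have hn : 0 < p * β + 1 := by omega
  rcases lt_trichotomy t 1 with ht | ht | ht
  · exact @not_one_lt_of_torus_meridian_eq_zpow G _ (OrderDual.instLinearOrder G)
      (fun g u v h => hLO g v u h) x y i j _ _ (by omega) (by omega) hix hj hn hnm a b t hz (rel1 ▸ hz) hm ht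
  · rw [ht, one_zpow] at hz
    exact hnontriv ⟨eq_one_of_zpow_eq_one_of_pos hLO (by omega) hz,
      eq_one_of_zpow_eq_one_of_pos hLO (by omega) (rel1 ▸ hz), ht⟩
  · exact not_one_lt_of_torus_meridian_eq_zpow hLO (by omega) (by omega) hix hj hn hnm hz
      (rel1 ▸ hz) hm ht
end

section
/- Let G be a group equipped with a linear order < such that left multiplication preserves the order, and let a, b, t ∈ G satisfy the cable-knot relations a^x = b^y and t^p = μ^q * λ^p. Then t, a and b all have the same sign; explicitly: (1 < a ↔ 1 < b), (1 < a ↔ 1 < t), (a < 1 ↔ b < 1), and (a < 1 ↔ t < 1). -/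
section LeftOrdered

variable {G : Type*} [Group G] [LinearOrder G] [MulLeftMono G]

theorem one_lt_zpow_iff_of_pos {n : ℤ} (hn : 0 < n) (g : G) : 1 < g ^ n ↔ 1 < g := by
  lift n to ℕ using hn.le
  rw [zpow_natCast]
  exact one_lt_pow_iff (by omega)

/-- If `a ^ x = b ^ y` with `x`, `y` positive, then `b ^ j * a ^ i < a ^ x` whenever `1 < a`,
`j < 0` and `i < x`. -/
theorem zpow_mul_zpow_lt_of_zpow_eq_zpow {a b : G} {x y i j : ℤ} (hy : 0 < y)
    (hj : j < 0) (hix : i < x) (hx : 0 < x) (rel : a ^ x = b ^ y) (ha : 1 < a) :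
    b ^ j * a ^ i < a ^ x := by
  have hb : 1 < b := by
    rwa [← one_lt_zpow_iff_of_pos hy, ← rel, one_lt_zpow_iff_of_pos hx]
  have hai : a ^ i < a ^ x := by
    have h := (one_lt_zpow_iff_of_pos (sub_pos.2 hix) a).2 ha
    calc a ^ i < a ^ i * a ^ (x - i) := lt_mul_of_one_lt_right' _ h
      _ = a ^ x := by rw [← zpow_add, add_sub_cancel]
  have hbj : b ^ j < 1 := by
    have h := (one_lt_zpow_iff_of_pos (neg_pos.2 hj) b).2 hb
    rwa [zpow_neg, Left.one_lt_inv_iff] at h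
  calc b ^ j * a ^ i < b ^ j * a ^ x := mul_lt_mul_right hai _
    _ = a ^ x * b ^ j := by rw [rel, ← zpow_add, ← zpow_add, add_comm]
    _ < a ^ x := mul_lt_of_lt_one_right' _ hbj

theorem one_lt_of_zpow_eq_inv_mul_zpow {a b t : G} {x y i j p : ℤ} (hy : 0 < y)
    (hj : j < 0) (hix : i < x) (hx : 0 < x) (hp : 1 < p) (rel : a ^ x = b ^ y)
    (ht : t ^ p = (b ^ j * a ^ i)⁻¹ * (a ^ x) ^ p) (ha : 1 < a) : 1 < t := by
  rw [← one_lt_zpow_iff_of_pos (by omega : 0 < p), ht, lt_inv_mul_iff_mul_lt, mul_one]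
  refine (zpow_mul_zpow_lt_of_zpow_eq_zpow hy hj hix hx rel ha).trans ?_
  have h : 1 < (a ^ x) ^ (p - 1) := by
    rwa [one_lt_zpow_iff_of_pos (by omega), one_lt_zpow_iff_of_pos hx]
  calc a ^ x < a ^ x * (a ^ x) ^ (p - 1) := lt_mul_of_one_lt_right' _ h
    _ = (a ^ x) ^ p := by rw [← zpow_one_add, add_sub_cancel]

end LeftOrdered

/-- In the cable-knot relations, `μ ^ q * λ ^ p` simplifies to `μ⁻¹ * (a ^ x) ^ p`. -/
theorem meridian_zpow_mul_longitude_zpow {G : Type*} [Group G] {a b : G} {x y i j p : ℤ}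
    (rel : a ^ x = b ^ y) :
    (b ^ j * a ^ i) ^ (p * x * y - 1) * ((b ^ j * a ^ i) ^ (-(x * y)) * a ^ x) ^ p =
      (b ^ j * a ^ i)⁻¹ * (a ^ x) ^ p := by
  have hcomm : Commute (b ^ j * a ^ i) (a ^ x) := by
    refine Commute.mul_left ?_ (Commute.zpow_zpow_self a i x)
    rw [rel]
    exact Commute.zpow_zpow_self b j y
  rw [(hcomm.zpow_left _).mul_zpow, ← zpow_mul, ← mul_assoc, ← zpow_add,
    show p * x * y - 1 + -(x * y) * p = -1 by ring, zpow_neg_one]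

/-- In a left-ordered group satisfying the cable-knot relations, t, a and b
all have the same sign. -/
theorem stmt_6 {G : Type*} [Group G] [LinearOrder G]
    (hLO : ∀ g u v : G, u < v → g * u < g * v)
    (x y i j p q : ℤ) (hx : 2 ≤ x) (hy : 2 ≤ y) (hxy : Int.gcd x y = 1)
    (hij : x * j + y * i = 1) (hi : 0 < i) (hix : i < x)
    (hp : 2 ≤ p) (hq : q = p * x * y - 1)
    (a b t mu lam : G)
    (hmu : mu = b ^ j * a ^ i)
    (hlam : lam = mu ^ (-(x * y)) * a ^ x)
    (rel1 : a ^ x = b ^ y)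
    (rel2 : t ^ p = mu ^ q * lam ^ p) :
    (1 < a ↔ 1 < b) ∧ (1 < a ↔ 1 < t) ∧ (a < 1 ↔ b < 1) ∧ (a < 1 ↔ t < 1) := by
  have : MulLeftStrictMono G := ⟨fun g _ _ h => hLO g _ _ h⟩
  have : MulLeftStrictMono Gᵒᵈ := ⟨fun g _ _ h => hLO g _ _ h⟩
  have : MulLeftMono G := mulLeftMono_of_mulLeftStrictMono G
  have : MulLeftMono Gᵒᵈ := mulLeftMono_of_mulLeftStrictMono Gᵒᵈ
  have hx0 : 0 < x := by omega
  have hy0 : 0 < y := by omega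
  have hp0 : 0 < p := by omega
  have hj : j < 0 := by nlinarith
  subst hlam hmu hq
  rw [meridian_zpow_mul_longitude_zpow rel1] at rel2
  have hab : 1 < a ↔ 1 < b := by
    rw [← one_lt_zpow_iff_of_pos hx0 a, rel1, one_lt_zpow_iff_of_pos hy0]
  have hab' : a < 1 ↔ b < 1 := by
    have h₁ : a ^ x < 1 ↔ a < 1 := one_lt_zpow_iff_of_pos (G := Gᵒᵈ) hx0 a
    have h₂ : b ^ y < 1 ↔ b < 1 := one_lt_zpow_iff_of_pos (G := Gᵒᵈ) hy0 b
    rw [← h₁, rel1, h₂]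
  have hat : 1 < a → 1 < t :=
    one_lt_of_zpow_eq_inv_mul_zpow hy0 hj hix hx0 (by omega) rel1 rel2
  have hat' : a < 1 → t < 1 :=
    one_lt_of_zpow_eq_inv_mul_zpow (G := Gᵒᵈ) hy0 hj hix hx0 (by omega) rel1 rel2
  have hat_one : a = 1 → t = 1 := by
    intro ha
    have hb : b = 1 := le_antisymm (not_lt.1 (hab.not.1 ha.le.not_gt))
      (not_lt.1 (hab'.not.1 ha.ge.not_gt))
    have ht : t ^ p = 1 := by simp [rel2, ha, hb]
    have h₁ := one_lt_zpow_iff_of_pos hp0 t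
    have h₂ : t ^ p < 1 ↔ t < 1 := one_lt_zpow_iff_of_pos (G := Gᵒᵈ) hp0 t
    exact le_antisymm (not_lt.1 (h₁.not.1 ht.le.not_gt)) (not_lt.1 (h₂.not.1 ht.ge.not_gt))
  refine ⟨hab, ⟨hat, fun ht => ?_⟩, hab', hat', fun ht => ?_⟩
  · rcases lt_trichotomy a 1 with h | h | h
    · exact absurd (hat' h) ht.not_gt
    · exact absurd (hat_one h) ht.ne'
    · exact h
  · rcases lt_trichotomy a 1 with h | h | h
    · exact h
    · exact absurd (hat_one h) ht.ne
    · exact absurd (hat h) ht.not_gt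
end
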